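/- Let a, b, c ∈ ℝ² be three affinely independent points that are positively oriented, i.e. det(b − a, c − a) > 0, and let d ∈ ℝ². Let o ∈ ℝ² and r > 0 be the circumcenter and circumradius of the triangle abc, i.e. the unique point o equidistant from a, b, c with r = ‖a − o‖ = ‖b − o‖ = ‖c − o‖. Then ‖d − o‖ < r if and only if the 4×4 determinant with rows (p_x, p_y, p_x² + p_y², 1) for p = a, b, c, d (in this order) is positive; moreover ‖d − o‖ = r if and only if this determinant is zero. -/

import Mathlib

/-- Expansion of the incircle determinant along its third column, after translating that column
so that it vanishes at the three points of the circle with center `(u, v)` and squared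
radius `R`. -/
theorem incircle_det_eq (a₀ a₁ b₀ b₁ c₀ c₁ q₀ q₁ u v R : ℝ)
    (ha : (a₀ - u) ^ 2 + (a₁ - v) ^ 2 = R)
    (hb : (b₀ - u) ^ 2 + (b₁ - v) ^ 2 = R)
    (hc : (c₀ - u) ^ 2 + (c₁ - v) ^ 2 = R) :
    Matrix.det
      !![a₀, a₁, a₀ ^ 2 + a₁ ^ 2, 1;
         b₀, b₁, b₀ ^ 2 + b₁ ^ 2, 1;
         c₀, c₁, c₀ ^ 2 + c₁ ^ 2, 1;
         q₀, q₁, q₀ ^ 2 + q₁ ^ 2, 1] =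
      Matrix.det !![b₀ - a₀, c₀ - a₀; b₁ - a₁, c₁ - a₁] *
        (R - ((q₀ - u) ^ 2 + (q₁ - v) ^ 2)) := by
  simp only [Matrix.det_succ_row_zero, Fin.sum_univ_succ, Matrix.submatrix, Matrix.of_apply,
    Fin.succAbove, Matrix.det_unique]
  simp
  linear_combination
    ((c₀ - b₀) * (q₁ - b₁) - (c₁ - b₁) * (q₀ - b₀)) * ha -
    ((c₀ - a₀) * (q₁ - a₁) - (c₁ - a₁) * (q₀ - a₀)) * hb +
    ((b₀ - a₀) * (q₁ - a₁) - (b₁ - a₁) * (q₀ - a₀)) * hc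

/-- The squared norm of a difference in the Euclidean plane, in coordinates. -/
theorem EuclideanSpace.norm_sub_sq_fin_two (p o : EuclideanSpace ℝ (Fin 2)) :
    ‖p - o‖ ^ 2 = (p 0 - o 0) ^ 2 + (p 1 - o 1) ^ 2 := by
  simp [EuclideanSpace.real_norm_sq_eq, Fin.sum_univ_two]

/-- The incircle predicate: for a positively oriented triangle `a b c` in the
plane with circumcenter `o` and circumradius `r`, a query point `q` lies
strictly inside the circumcircle iff the 4×4 incircle determinant (with rows
`(pₓ, p_y, pₓ² + p_y², 1)` for `p = a, b, c, q`) is positive, and on the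
circle iff the determinant is zero. -/
theorem incircle_predicate
    (a b c q o : EuclideanSpace ℝ (Fin 2)) (r : ℝ) (hr : 0 < r)
    (horient :
      0 < Matrix.det !![b 0 - a 0, c 0 - a 0; b 1 - a 1, c 1 - a 1])
    (ha : ‖a - o‖ = r) (hb : ‖b - o‖ = r) (hc : ‖c - o‖ = r) :
    (‖q - o‖ < r ↔
        0 < Matrix.det
          !![a 0, a 1, a 0 ^ 2 + a 1 ^ 2, 1;
             b 0, b 1, b 0 ^ 2 + b 1 ^ 2, 1;
             c 0, c 1, c 0 ^ 2 + c 1 ^ 2, 1;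
             q 0, q 1, q 0 ^ 2 + q 1 ^ 2, 1]) ∧
      (‖q - o‖ = r ↔
        Matrix.det
          !![a 0, a 1, a 0 ^ 2 + a 1 ^ 2, 1;
             b 0, b 1, b 0 ^ 2 + b 1 ^ 2, 1;
             c 0, c 1, c 0 ^ 2 + c 1 ^ 2, 1;
             q 0, q 1, q 0 ^ 2 + q 1 ^ 2, 1] = 0) := by
  have hdet := incircle_det_eq (a 0) (a 1) (b 0) (b 1) (c 0) (c 1) (q 0) (q 1) (o 0) (o 1) (r ^ 2)
    (by rw [← EuclideanSpace.norm_sub_sq_fin_two, ha])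
    (by rw [← EuclideanSpace.norm_sub_sq_fin_two, hb])
    (by rw [← EuclideanSpace.norm_sub_sq_fin_two, hc])
  rw [hdet, ← EuclideanSpace.norm_sub_sq_fin_two, mul_pos_iff_of_pos_left horient,
    mul_eq_zero_iff_left horient.ne', sub_pos, sub_eq_zero,
    pow_lt_pow_iff_left₀ (norm_nonneg _) hr.le two_ne_zero,
    pow_left_inj₀ hr.le (norm_nonneg _) two_ne_zero]
  exact ⟨Iff.rfl, eq_comm⟩
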